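/- Subject reduction holds for CCω: if Γ ⊢ t : T and t → t', then Γ ⊢ t' : T. -/

import Mathlib

/-! Formalization of CCω (terms, reduction, conversion, undirected and
bidirectional typing, cumulativity) using de Bruijn indices, following
Lennon-Bertrand, "Complete Bidirectional Typing for the Calculus of
Inductive Constructions". -/

namespace CComega

/-- Terms of CCω: `t ::= x | □_i | Πx:t.t | λx:t.t | t t`,
with variables as de Bruijn indices. -/
inductive Tm : Type
  | var : ℕ → Tm
  | sort : ℕ → Tm
  | pi : Tm → Tm → Tm
  | lam : Tm → Tm → Tm
  | app : Tm → Tm → Tm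
deriving DecidableEq

/-- `lift n k t` shifts by `n` the de Bruijn indices of `t` that are ≥ `k`. -/
def lift (n k : ℕ) : Tm → Tm
  | .var i => if i < k then .var i else .var (i + n)
  | .sort i => .sort i
  | .pi A B => .pi (lift n k A) (lift n (k + 1) B)
  | .lam A t => .lam (lift n k A) (lift n (k + 1) t)
  | .app t u => .app (lift n k t) (lift n k u)

/-- `subst u k t` is the capture-avoiding substitution `t[u/k]` of `u`
for de Bruijn index `k` in `t`. -/
def subst (u : Tm) (k : ℕ) : Tm → Tm
  | .var i => if i < k then .var i else if i = k then lift k 0 u else .var (i - 1)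
  | .sort i => .sort i
  | .pi A B => .pi (subst u k A) (subst u (k + 1) B)
  | .lam A t => .lam (subst u k A) (subst u (k + 1) t)
  | .app t v => .app (subst u k t) (subst u k v)

/-- One-step reduction `t → t'`: the least congruence such that
`(λx:A.t) u → t[u/x]`. -/
inductive Red : Tm → Tm → Prop
  | beta (A t u : Tm) : Red (.app (.lam A t) u) (subst u 0 t)
  | piDom {A A'} (B : Tm) : Red A A' → Red (.pi A B) (.pi A' B)
  | piCod (A : Tm) {B B'} : Red B B' → Red (.pi A B) (.pi A B')
  | lamDom {A A'} (t : Tm) : Red A A' → Red (.lam A t) (.lam A' t)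
  | lamBody (A : Tm) {t t'} : Red t t' → Red (.lam A t) (.lam A t')
  | appFun {t t'} (u : Tm) : Red t t' → Red (.app t u) (.app t' u)
  | appArg (t : Tm) {u u'} : Red u u' → Red (.app t u) (.app t u')

/-- Multi-step reduction `t ↠ t'`: reflexive-transitive closure of `→`. -/
def Reds : Tm → Tm → Prop := Relation.ReflTransGen Red

/-- Conversion `t ≡ u`: symmetric, reflexive, transitive closure of `→`. -/
def Conv : Tm → Tm → Prop := Relation.EqvGen Red

/-- Contexts are lists of (de Bruijn) declarations, most recent first. -/
abbrev Ctx := List Tm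

mutual
/-- Context well-formedness `⊢ Γ`. -/
inductive WfCtx : Ctx → Prop
  | nil : WfCtx []
  | cons {Γ A i} : WfCtx Γ → Typed Γ A (.sort i) → WfCtx (A :: Γ)

/-- Undirected typing `Γ ⊢ t : T`. -/
inductive Typed : Ctx → Tm → Tm → Prop
  | sort {Γ i} : WfCtx Γ → Typed Γ (.sort i) (.sort (i + 1))
  | var {Γ n A} : WfCtx Γ → Γ[n]? = some A → Typed Γ (.var n) (lift (n + 1) 0 A)
  | pi {Γ A B i j} : Typed Γ A (.sort i) → Typed (A :: Γ) B (.sort j) →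
      Typed Γ (.pi A B) (.sort (max i j))
  | lam {Γ A B t i} : Typed Γ (.pi A B) (.sort i) → Typed (A :: Γ) t B →
      Typed Γ (.lam A t) (.pi A B)
  | app {Γ t u A B} : Typed Γ t (.pi A B) → Typed Γ u A →
      Typed Γ (.app t u) (subst u 0 B)
  | conv {Γ t A B i} : Typed Γ t A → Typed Γ B (.sort i) → Conv A B →
      Typed Γ t B
end

mutual
/-- Bidirectional inference `Γ ⊢ t ▹ T`. -/
inductive Infer : Ctx → Tm → Tm → Prop
  | sort {Γ i} : Infer Γ (.sort i) (.sort (i + 1))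
  | var {Γ n A} : Γ[n]? = some A → Infer Γ (.var n) (lift (n + 1) 0 A)
  | pi {Γ A B i j} : InferSort Γ A (.sort i) → InferSort (A :: Γ) B (.sort j) →
      Infer Γ (.pi A B) (.sort (max i j))
  | lam {Γ A t B i} : InferSort Γ A (.sort i) → Infer (A :: Γ) t B →
      Infer Γ (.lam A t) (.pi A B)
  | app {Γ t u A B} : InferPi Γ t (.pi A B) → Check Γ u A →
      Infer Γ (.app t u) (subst u 0 B)

/-- Bidirectional checking `Γ ⊢ t ◃ T`. -/
inductive Check : Ctx → Tm → Tm → Prop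
  | check {Γ t T T'} : Infer Γ t T' → Conv T' T → Check Γ t T

/-- Constrained inference `Γ ⊢ t ▹_□ T` (the output is a universe). -/
inductive InferSort : Ctx → Tm → Tm → Prop
  | inferSort {Γ t T i} : Infer Γ t T → Reds T (.sort i) → InferSort Γ t (.sort i)

/-- Constrained inference `Γ ⊢ t ▹_Π T` (the output is a product type). -/
inductive InferPi : Ctx → Tm → Tm → Prop
  | inferPi {Γ t T A B} : Infer Γ t T → Reds T (.pi A B) → InferPi Γ t (.pi A B)
end

/-- Weak-head reduction `t ⇝ t'`: reduction only at the head. -/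
inductive WhRed : Tm → Tm → Prop
  | beta (A t u : Tm) : WhRed (.app (.lam A t) u) (subst u 0 t)
  | appFun {t t'} (u : Tm) : WhRed t t' → WhRed (.app t u) (.app t' u)

/-- Multi-step weak-head reduction `t ⇝* t'`. -/
def WhReds : Tm → Tm → Prop := Relation.ReflTransGen WhRed

mutual
/-- Weak-head bidirectional inference: as `Infer`, but constrained inference
uses weak-head reduction. -/
inductive InferW : Ctx → Tm → Tm → Prop
  | sort {Γ i} : InferW Γ (.sort i) (.sort (i + 1))
  | var {Γ n A} : Γ[n]? = some A → InferW Γ (.var n) (lift (n + 1) 0 A)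
  | pi {Γ A B i j} : InferSortW Γ A (.sort i) → InferSortW (A :: Γ) B (.sort j) →
      InferW Γ (.pi A B) (.sort (max i j))
  | lam {Γ A t B i} : InferSortW Γ A (.sort i) → InferW (A :: Γ) t B →
      InferW Γ (.lam A t) (.pi A B)
  | app {Γ t u A B} : InferPiW Γ t (.pi A B) → CheckW Γ u A →
      InferW Γ (.app t u) (subst u 0 B)

/-- Weak-head bidirectional checking. -/
inductive CheckW : Ctx → Tm → Tm → Prop
  | check {Γ t T T'} : InferW Γ t T' → Conv T' T → CheckW Γ t T

/-- Weak-head constrained inference `Γ ⊢ t ▹_□ T`. -/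
inductive InferSortW : Ctx → Tm → Tm → Prop
  | inferSort {Γ t T i} : InferW Γ t T → WhReds T (.sort i) →
      InferSortW Γ t (.sort i)

/-- Weak-head constrained inference `Γ ⊢ t ▹_Π T`. -/
inductive InferPiW : Ctx → Tm → Tm → Prop
  | inferPi {Γ t T A B} : InferW Γ t T → WhReds T (.pi A B) →
      InferPiW Γ t (.pi A B)
end

/-- Cumulativity `t ≼ u`: the least transitive relation containing conversion
such that `□_i ≼ □_j` whenever `i ≤ j` and `Πx:A.B ≼ Πx:A'.B'` whenever
`A ≡ A'` and `B ≼ B'`. -/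
inductive Cum : Tm → Tm → Prop
  | ofConv {t u} : Conv t u → Cum t u
  | sort {i j : ℕ} : i ≤ j → Cum (.sort i) (.sort j)
  | pi {A A' B B'} : Conv A A' → Cum B B' → Cum (.pi A B) (.pi A' B')
  | trans {t u v} : Cum t u → Cum u v → Cum t v

mutual
/-- Context well-formedness for the cumulative undirected system. -/
inductive WfCtxC : Ctx → Prop
  | nil : WfCtxC []
  | cons {Γ A i} : WfCtxC Γ → TypedC Γ A (.sort i) → WfCtxC (A :: Γ)

/-- Cumulative undirected typing `Γ ⊢ t : T`: as `Typed`, with the conversion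
rule replaced by cumulativity. -/
inductive TypedC : Ctx → Tm → Tm → Prop
  | sort {Γ i} : WfCtxC Γ → TypedC Γ (.sort i) (.sort (i + 1))
  | var {Γ n A} : WfCtxC Γ → Γ[n]? = some A → TypedC Γ (.var n) (lift (n + 1) 0 A)
  | pi {Γ A B i j} : TypedC Γ A (.sort i) → TypedC (A :: Γ) B (.sort j) →
      TypedC Γ (.pi A B) (.sort (max i j))
  | lam {Γ A B t i} : TypedC Γ (.pi A B) (.sort i) → TypedC (A :: Γ) t B →
      TypedC Γ (.lam A t) (.pi A B)
  | app {Γ t u A B} : TypedC Γ t (.pi A B) → TypedC Γ u A →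
      TypedC Γ (.app t u) (subst u 0 B)
  | cumul {Γ t A B i} : TypedC Γ t A → TypedC Γ B (.sort i) → Cum A B →
      TypedC Γ t B
end

mutual
/-- Cumulative bidirectional inference `Γ ⊢ t ▹ T`. -/
inductive InferC : Ctx → Tm → Tm → Prop
  | sort {Γ i} : InferC Γ (.sort i) (.sort (i + 1))
  | var {Γ n A} : Γ[n]? = some A → InferC Γ (.var n) (lift (n + 1) 0 A)
  | pi {Γ A B i j} : InferSortC Γ A (.sort i) → InferSortC (A :: Γ) B (.sort j) →
      InferC Γ (.pi A B) (.sort (max i j))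
  | lam {Γ A t B i} : InferSortC Γ A (.sort i) → InferC (A :: Γ) t B →
      InferC Γ (.lam A t) (.pi A B)
  | app {Γ t u A B} : InferPiC Γ t (.pi A B) → CheckC Γ u A →
      InferC Γ (.app t u) (subst u 0 B)

/-- Cumulative bidirectional checking `Γ ⊢ t ◃ T`, using cumulativity. -/
inductive CheckC : Ctx → Tm → Tm → Prop
  | check {Γ t T T'} : InferC Γ t T' → Cum T' T → CheckC Γ t T

/-- Cumulative constrained inference `Γ ⊢ t ▹_□ T` (unchanged: uses reduction). -/
inductive InferSortC : Ctx → Tm → Tm → Prop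
  | inferSort {Γ t T i} : InferC Γ t T → Reds T (.sort i) → InferSortC Γ t (.sort i)

/-- Cumulative constrained inference `Γ ⊢ t ▹_Π T` (unchanged: uses reduction). -/
inductive InferPiC : Ctx → Tm → Tm → Prop
  | inferPi {Γ t T A B} : InferC Γ t T → Reds T (.pi A B) → InferPiC Γ t (.pi A B)
end

/-! ### Parallel renamings and substitutions -/

/-- Extension of a renaming under a binder. -/
def upRen (ξ : ℕ → ℕ) : ℕ → ℕ
  | 0 => 0
  | i + 1 => ξ i + 1

/-- Parallel renaming of variables. -/
def rename (ξ : ℕ → ℕ) : Tm → Tm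
  | .var i => .var (ξ i)
  | .sort i => .sort i
  | .pi A B => .pi (rename ξ A) (rename (upRen ξ) B)
  | .lam A t => .lam (rename ξ A) (rename (upRen ξ) t)
  | .app t u => .app (rename ξ t) (rename ξ u)

/-- Extension of a substitution under a binder. -/
def upSub (σ : ℕ → Tm) : ℕ → Tm
  | 0 => .var 0
  | i + 1 => rename Nat.succ (σ i)

/-- Parallel substitution. -/
def psubst (σ : ℕ → Tm) : Tm → Tm
  | .var i => σ i
  | .sort i => .sort i
  | .pi A B => .pi (psubst σ A) (psubst (upSub σ) B)
  | .lam A t => .lam (psubst σ A) (psubst (upSub σ) t)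
  | .app t u => .app (psubst σ t) (psubst σ u)

/-- The substitution mapping `0` to `u` and `i + 1` to `σ i`. -/
def scons (u : Tm) (σ : ℕ → Tm) : ℕ → Tm
  | 0 => u
  | i + 1 => σ i

theorem rename_rename (ξ ζ : ℕ → ℕ) (t : Tm) :
    rename ξ (rename ζ t) = rename (ξ ∘ ζ) t := by
  have hup (ξ ζ : ℕ → ℕ) : upRen ξ ∘ upRen ζ = upRen (ξ ∘ ζ) := by
    funext i; cases i <;> rfl
  induction t generalizing ξ ζ <;> simp_all [rename]

theorem psubst_rename (σ : ℕ → Tm) (ξ : ℕ → ℕ) (t : Tm) :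
    psubst σ (rename ξ t) = psubst (σ ∘ ξ) t := by
  have hup (σ : ℕ → Tm) (ξ : ℕ → ℕ) : upSub σ ∘ upRen ξ = upSub (σ ∘ ξ) := by
    funext i; cases i <;> rfl
  induction t generalizing σ ξ <;> simp_all [rename, psubst]

theorem rename_psubst (ξ : ℕ → ℕ) (σ : ℕ → Tm) (t : Tm) :
    rename ξ (psubst σ t) = psubst (rename ξ ∘ σ) t := by
  have hup (ξ : ℕ → ℕ) (σ : ℕ → Tm) :
      rename (upRen ξ) ∘ upSub σ = upSub (rename ξ ∘ σ) := by
    funext i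
    cases i with
    | zero => rfl
    | succ i => simp only [Function.comp, upSub, rename_rename]; rfl
  induction t generalizing σ ξ <;> simp_all [rename, psubst]

theorem psubst_psubst (σ τ : ℕ → Tm) (t : Tm) :
    psubst σ (psubst τ t) = psubst (psubst σ ∘ τ) t := by
  have hup (σ τ : ℕ → Tm) : psubst (upSub σ) ∘ upSub τ = upSub (psubst σ ∘ τ) := by
    funext i
    cases i with
    | zero => rfl
    | succ i => simp only [Function.comp, upSub, psubst_rename, rename_psubst]; rfl
  induction t generalizing σ τ <;> simp_all [psubst]

theorem psubst_var (t : Tm) : psubst .var t = t := by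
  have hup : upSub .var = .var := by
    funext i; cases i <;> rfl
  induction t <;> simp_all [psubst]

theorem rename_eq_psubst (ξ : ℕ → ℕ) (t : Tm) : rename ξ t = psubst (.var ∘ ξ) t := by
  rw [← psubst_rename, psubst_var]

theorem lift_eq_rename (n k : ℕ) (t : Tm) :
    lift n k t = rename (fun i => if i < k then i else i + n) t := by
  have hup (k : ℕ) : upRen (fun i => if i < k then i else i + n) =
      fun i => if i < k + 1 then i else i + n := by
    funext i
    cases i with
    | zero => simp [upRen]
    | succ i => simp only [upRen]; split_ifs <;> omega
  induction t generalizing k with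
  | var i => simp only [lift, rename]; split_ifs <;> rfl
  | _ => simp_all [lift, rename]

theorem lift_zero_eq (n : ℕ) (t : Tm) : lift n 0 t = rename (· + n) t := by
  simp [lift_eq_rename]

theorem lift_zero_zero (t : Tm) : lift 0 0 t = t := by
  rw [lift_zero_eq, rename_eq_psubst]
  exact psubst_var t

theorem subst_zero_eq (u t : Tm) : subst u 0 t = psubst (scons u .var) t := by
  have key (k : ℕ) : subst u k t = psubst (fun i => if i < k then .var i else
      if i = k then lift k 0 u else .var (i - 1)) t := by
    have hup (k : ℕ) : upSub (fun i => if i < k then .var i else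
        if i = k then lift k 0 u else .var (i - 1)) = fun i => if i < k + 1 then .var i else
        if i = k + 1 then lift (k + 1) 0 u else .var (i - 1) := by
      funext i
      cases i with
      | zero => simp [upSub]
      | succ i =>
        simp only [upSub, Nat.add_lt_add_iff_right, Nat.add_right_cancel_iff]
        split_ifs with h1 h2
        · rfl
        · simp only [lift_zero_eq, rename_rename]; rfl
        · simp only [rename]; congr 1; omega
    induction t generalizing k with
    | var i => rfl
    | _ => simp_all [subst, psubst]
  rw [key]
  congr 1
  funext i
  cases i with
  | zero => exact lift_zero_zero u
  | succ i => simp [scons]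

theorem psubst_subst_zero (σ : ℕ → Tm) (u t : Tm) :
    psubst σ (subst u 0 t) = subst (psubst σ u) 0 (psubst (upSub σ) t) := by
  simp only [subst_zero_eq, psubst_psubst]
  congr 1
  funext i
  cases i with
  | zero => rfl
  | succ i =>
    simp only [Function.comp, scons, upSub, psubst_rename, psubst]
    exact (psubst_var _).symm

theorem rename_subst_zero (ξ : ℕ → ℕ) (u t : Tm) :
    rename ξ (subst u 0 t) = subst (rename ξ u) 0 (rename (upRen ξ) t) := by
  have hup : upSub (.var ∘ ξ) = .var ∘ upRen ξ := by
    funext i; cases i <;> rfl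
  simp only [rename_eq_psubst, psubst_subst_zero, hup]

/-! ### Parallel reduction and confluence -/

/-- Parallel reduction. -/
inductive Par : Tm → Tm → Prop
  | var (i : ℕ) : Par (.var i) (.var i)
  | sort (i : ℕ) : Par (.sort i) (.sort i)
  | pi {A A' B B'} : Par A A' → Par B B' → Par (.pi A B) (.pi A' B')
  | lam {A A' t t'} : Par A A' → Par t t' → Par (.lam A t) (.lam A' t')
  | app {t t' u u'} : Par t t' → Par u u' → Par (.app t u) (.app t' u')
  | beta (A : Tm) {t t' u u'} : Par t t' → Par u u' →
      Par (.app (.lam A t) u) (subst u' 0 t')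

theorem Par.refl (t : Tm) : Par t t := by
  induction t <;> constructor <;> assumption

theorem Red.par {t t' : Tm} (h : Red t t') : Par t t' := by
  induction h with
  | beta A t u => exact .beta A (.refl t) (.refl u)
  | _ => constructor <;> first | assumption | exact .refl _

theorem Par.rename {t t' : Tm} (h : Par t t') (ξ : ℕ → ℕ) :
    Par (rename ξ t) (rename ξ t') := by
  induction h generalizing ξ with
  | beta A _ _ iht ihu => rw [rename_subst_zero]; exact .beta _ (iht _) (ihu _)
  | _ => constructor <;> apply_assumption

theorem Par.upSub {σ τ : ℕ → Tm} (h : ∀ i, Par (σ i) (τ i)) (i : ℕ) :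
    Par (upSub σ i) (upSub τ i) := by
  cases i with
  | zero => exact .var 0
  | succ i => exact (h i).rename _

theorem Par.psubst {t t' : Tm} (h : Par t t') {σ τ : ℕ → Tm}
    (hσ : ∀ i, Par (σ i) (τ i)) : Par (psubst σ t) (psubst τ t') := by
  induction h generalizing σ τ with
  | var i => exact hσ i
  | sort i => exact .sort i
  | pi _ _ ihA ihB => exact .pi (ihA hσ) (ihB (.upSub hσ))
  | lam _ _ ihA iht => exact .lam (ihA hσ) (iht (.upSub hσ))
  | app _ _ iht ihu => exact .app (iht hσ) (ihu hσ)
  | beta A _ _ iht ihu =>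
    rw [psubst_subst_zero]
    exact .beta _ (iht (.upSub hσ)) (ihu hσ)

theorem Par.subst_zero {t t' u u' : Tm} (ht : Par t t') (hu : Par u u') :
    Par (subst u 0 t) (subst u' 0 t') := by
  simp only [subst_zero_eq]
  refine ht.psubst fun i => ?_
  cases i with
  | zero => exact hu
  | succ i => exact .var i

/-- Complete development. -/
def develop : Tm → Tm
  | .var i => .var i
  | .sort i => .sort i
  | .pi A B => .pi (develop A) (develop B)
  | .lam A t => .lam (develop A) (develop t)
  | .app (.lam _ t) u => subst (develop u) 0 (develop t)
  | .app t u => .app (develop t) (develop u)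

theorem Par.triangle {t t' : Tm} (h : Par t t') : Par t' (develop t) := by
  induction h with
  | var i => exact .var i
  | sort i => exact .sort i
  | pi _ _ ihA ihB => exact .pi ihA ihB
  | lam _ _ ihA iht => exact .lam ihA iht
  | beta A _ _ iht ihu => exact iht.subst_zero ihu
  | @app t t' u u' ht _ iht ihu =>
    cases t with
    | lam A t =>
      cases ht with
      | lam hA ht =>
        cases iht with
        | lam ihA iht => exact .beta _ iht ihu
    | _ => exact .app iht ihu

theorem Conv.trans {t u v : Tm} (h₁ : Conv t u) (h₂ : Conv u v) : Conv t v :=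
  Relation.EqvGen.trans _ _ _ h₁ h₂

theorem Conv.symm {t u : Tm} (h : Conv t u) : Conv u t :=
  Relation.EqvGen.symm _ _ h

theorem Conv.refl (t : Tm) : Conv t t :=
  Relation.EqvGen.refl t

theorem Red.conv {t u : Tm} (h : Red t u) : Conv t u :=
  Relation.EqvGen.rel _ _ h

theorem Conv.map {f : Tm → Tm} (hf : ∀ {t u}, Red t u → Red (f t) (f u)) {t u : Tm}
    (h : Conv t u) : Conv (f t) (f u) := by
  induction h with
  | rel _ _ h => exact (hf h).conv
  | refl _ => exact .refl _
  | symm _ _ _ ih => exact ih.symm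
  | trans _ _ _ _ _ ih₁ ih₂ => exact ih₁.trans ih₂

theorem Par.conv {t t' : Tm} (h : Par t t') : Conv t t' := by
  induction h with
  | var i => exact .refl _
  | sort i => exact .refl _
  | @pi A A' B B' _ _ ihA ihB =>
    exact (ihA.map (.piDom B)).trans (ihB.map (.piCod A'))
  | @lam A A' t t' _ _ ihA iht =>
    exact (ihA.map (.lamDom t)).trans (iht.map (.lamBody A'))
  | @app t t' u u' _ _ iht ihu =>
    exact (iht.map (.appFun u)).trans (ihu.map (.appArg t'))
  | @beta A t t' u u' _ _ iht ihu =>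
    exact ((iht.map fun h => .appFun u (.lamBody A h)).trans
      (ihu.map (.appArg _))).trans (Red.beta A t' u').conv

theorem Conv.of_par_reds {t u : Tm} (h : Relation.ReflTransGen Par t u) : Conv t u := by
  induction h with
  | refl => exact .refl _
  | tail _ h ih => exact ih.trans h.conv

/-- Church–Rosser property of conversion. -/
theorem Conv.join {t u : Tm} (h : Conv t u) :
    Relation.Join (Relation.ReflTransGen Par) t u := by
  have equiv := Relation.equivalence_join_reflTransGen (r := Par) fun a b c hb hc =>
    ⟨develop a, .single hb.triangle, .single hc.triangle⟩
  induction h with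
  | rel _ _ h => exact ⟨_, .single h.par, .refl⟩
  | refl _ => exact equiv.refl _
  | symm _ _ _ ih => exact equiv.symm ih
  | trans _ _ _ _ _ ih₁ ih₂ => exact equiv.trans ih₁ ih₂

theorem Par.pi_reds {A B t : Tm} (h : Relation.ReflTransGen Par (.pi A B) t) :
    ∃ A' B', t = .pi A' B' ∧ Conv A A' ∧ Conv B B' := by
  induction h with
  | refl => exact ⟨A, B, rfl, .refl _, .refl _⟩
  | tail _ h ih =>
    obtain ⟨A', B', rfl, hA, hB⟩ := ih
    cases h with
    | pi hA' hB' => exact ⟨_, _, rfl, hA.trans hA'.conv, hB.trans hB'.conv⟩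

theorem Conv.pi_inj {A B A' B' : Tm} (h : Conv (.pi A B) (.pi A' B')) :
    Conv A A' ∧ Conv B B' := by
  obtain ⟨t, h₁, h₂⟩ := h.join
  obtain ⟨A₁, B₁, rfl, hA₁, hB₁⟩ := Par.pi_reds h₁
  obtain ⟨A₂, B₂, h, hA₂, hB₂⟩ := Par.pi_reds h₂
  cases h
  exact ⟨hA₁.trans hA₂.symm, hB₁.trans hB₂.symm⟩

theorem Conv.psubst {t u : Tm} (h : Conv t u) (σ : ℕ → Tm) :
    Conv (psubst σ t) (psubst σ u) := by
  induction h with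
  | rel _ _ h => exact (h.par.psubst fun i => .refl (σ i)).conv
  | refl _ => exact .refl _
  | symm _ _ _ ih => exact ih.symm
  | trans _ _ _ _ _ ih₁ ih₂ => exact ih₁.trans ih₂

theorem Conv.rename {t u : Tm} (h : Conv t u) (ξ : ℕ → ℕ) :
    Conv (rename ξ t) (rename ξ u) := by
  simpa only [rename_eq_psubst] using h.psubst _

/-! ### Metatheory of typing -/

theorem Typed.wf {Γ : Ctx} {t T : Tm} : Typed Γ t T → WfCtx Γ
  | .sort h => h
  | .var h _ => h
  | .pi hA _ => hA.wf
  | .lam hP _ => hP.wf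
  | .app ht _ => ht.wf
  | .conv ht _ _ => ht.wf

theorem Typed.pi_inv_of_eq {Γ : Ctx} {A B P T : Tm} : Typed Γ P T → P = .pi A B →
    (∃ i, Typed Γ A (.sort i)) ∧ ∃ j, Typed (A :: Γ) B (.sort j)
  | .pi hA hB, e => by cases e; exact ⟨⟨_, hA⟩, _, hB⟩
  | .conv h _ _, e => h.pi_inv_of_eq e

theorem Typed.pi_inv {Γ : Ctx} {A B T : Tm} (h : Typed Γ (.pi A B) T) :
    (∃ i, Typed Γ A (.sort i)) ∧ ∃ j, Typed (A :: Γ) B (.sort j) :=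
  h.pi_inv_of_eq rfl

theorem Typed.lam_inv_of_eq {Γ : Ctx} {A t l T : Tm} : Typed Γ l T → l = .lam A t →
    ∃ B i, Typed Γ (.pi A B) (.sort i) ∧ Typed (A :: Γ) t B ∧ Conv (.pi A B) T
  | .lam hP ht, e => by cases e; exact ⟨_, _, hP, ht, .refl _⟩
  | .conv h _ hc, e =>
    let ⟨B, i, hP, ht, hc'⟩ := h.lam_inv_of_eq e
    ⟨B, i, hP, ht, hc'.trans hc⟩

theorem Typed.lam_inv {Γ : Ctx} {A t T : Tm} (h : Typed Γ (.lam A t) T) :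
    ∃ B i, Typed Γ (.pi A B) (.sort i) ∧ Typed (A :: Γ) t B ∧ Conv (.pi A B) T :=
  h.lam_inv_of_eq rfl

/-- `ξ` is a renaming from `Γ` to `Δ`. -/
def WfRen (Γ Δ : Ctx) (ξ : ℕ → ℕ) : Prop :=
  ∀ n A, Γ[n]? = some A →
    ∃ B, Δ[ξ n]? = some B ∧ lift (ξ n + 1) 0 B = rename ξ (lift (n + 1) 0 A)

theorem WfRen.up {Γ Δ : Ctx} {ξ : ℕ → ℕ} (h : WfRen Γ Δ ξ) (A : Tm) :
    WfRen (A :: Γ) (rename ξ A :: Δ) (upRen ξ) := by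
  intro n C hn
  cases n with
  | zero =>
    obtain rfl : A = C := by simpa using hn
    refine ⟨_, rfl, ?_⟩
    simp only [lift_zero_eq, rename_rename]
    rfl
  | succ n =>
    obtain ⟨B, hB, e⟩ := h n C (by simpa using hn)
    refine ⟨B, by simpa [upRen] using hB, ?_⟩
    have := congrArg (rename Nat.succ) e
    simp only [lift_zero_eq, rename_rename] at this ⊢
    exact this

theorem Typed.rename {Γ : Ctx} {t T : Tm} : Typed Γ t T → ∀ {Δ : Ctx} {ξ : ℕ → ℕ},
    WfCtx Δ → WfRen Γ Δ ξ → Typed Δ (rename ξ t) (rename ξ T)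
  | .sort _, _, _, hΔ, _ => .sort hΔ
  | .var _ hn, _, _, hΔ, hξ => by
    obtain ⟨B, hB, e⟩ := hξ _ _ hn
    exact e ▸ .var hΔ hB
  | .pi hA hB, _, _, hΔ, hξ =>
    have hA' := hA.rename hΔ hξ
    .pi hA' (hB.rename (.cons hΔ hA') (hξ.up _))
  | .lam hP ht, _, _, hΔ, hξ =>
    have hP' := hP.rename hΔ hξ
    have ⟨_, hA'⟩ := hP'.pi_inv.1
    .lam hP' (ht.rename (.cons hΔ hA') (hξ.up _))
  | .app ht hu, _, _, hΔ, hξ => by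
    rw [rename_subst_zero]
    exact .app (ht.rename hΔ hξ) (hu.rename hΔ hξ)
  | .conv ht hB hc, _, _, hΔ, hξ =>
    .conv (ht.rename hΔ hξ) (hB.rename hΔ hξ) (hc.rename _)

theorem Typed.weaken {Γ : Ctx} {A t T : Tm} (h : Typed Γ t T) (hA : WfCtx (A :: Γ)) :
    Typed (A :: Γ) (CComega.rename Nat.succ t) (CComega.rename Nat.succ T) := by
  refine h.rename hA fun n B hn => ⟨B, by simpa using hn, ?_⟩
  simp only [lift_zero_eq, rename_rename]
  rfl

/-- `σ` is a well-typed substitution from `Γ` to `Δ`. -/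
def WfSub (Γ Δ : Ctx) (σ : ℕ → Tm) : Prop :=
  ∀ n A, Γ[n]? = some A → Typed Δ (σ n) (psubst σ (lift (n + 1) 0 A))

theorem WfSub.up {Γ Δ : Ctx} {σ : ℕ → Tm} (h : WfSub Γ Δ σ) {A : Tm}
    (hA : WfCtx (psubst σ A :: Δ)) : WfSub (A :: Γ) (psubst σ A :: Δ) (upSub σ) := by
  intro n C hn
  cases n with
  | zero =>
    obtain rfl : A = C := by simpa using hn
    have := Typed.var (n := 0) hA rfl
    simp only [lift_zero_eq, rename_psubst, psubst_rename] at this ⊢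
    exact this
  | succ n =>
    have := (h n C (by simpa using hn)).weaken hA
    simp only [lift_zero_eq, rename_psubst, psubst_rename] at this ⊢
    exact this

theorem Typed.psubst {Γ : Ctx} {t T : Tm} : Typed Γ t T → ∀ {Δ : Ctx} {σ : ℕ → Tm},
    WfCtx Δ → WfSub Γ Δ σ → Typed Δ (psubst σ t) (psubst σ T)
  | .sort _, _, _, hΔ, _ => .sort hΔ
  | .var _ hn, _, _, _, hσ => hσ _ _ hn
  | .pi hA hB, _, _, hΔ, hσ =>
    have hA' := hA.psubst hΔ hσ
    .pi hA' (hB.psubst (.cons hΔ hA') (hσ.up (.cons hΔ hA')))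
  | .lam hP ht, _, _, hΔ, hσ =>
    have hP' := hP.psubst hΔ hσ
    have ⟨_, hA'⟩ := hP'.pi_inv.1
    .lam hP' (ht.psubst (.cons hΔ hA') (hσ.up (.cons hΔ hA')))
  | .app ht hu, _, _, hΔ, hσ => by
    rw [psubst_subst_zero]
    exact .app (ht.psubst hΔ hσ) (hu.psubst hΔ hσ)
  | .conv ht hB hc, _, _, hΔ, hσ =>
    .conv (ht.psubst hΔ hσ) (hB.psubst hΔ hσ) (hc.psubst _)

theorem psubst_scons_lift_succ (u : Tm) (n : ℕ) (A : Tm) :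
    psubst (scons u .var) (lift (n + 1) 0 A) = lift n 0 A := by
  rw [lift_zero_eq, lift_zero_eq, psubst_rename, rename_eq_psubst]
  rfl

theorem Typed.subst_zero {Γ : Ctx} {A B t u : Tm} (ht : Typed (A :: Γ) t B)
    (hu : Typed Γ u A) : Typed Γ (subst u 0 t) (subst u 0 B) := by
  simp only [subst_zero_eq]
  refine ht.psubst hu.wf fun n C hn => ?_
  rw [psubst_scons_lift_succ]
  cases n with
  | zero =>
    obtain rfl : A = C := by simpa using hn
    rwa [lift_zero_zero]
  | succ n => exact .var hu.wf (by simpa using hn)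

theorem Typed.conv_ctx {Γ : Ctx} {A A' t T : Tm} {i j : ℕ} (ht : Typed (A :: Γ) t T)
    (hA : Typed Γ A (.sort i)) (hA' : Typed Γ A' (.sort j)) (hc : Conv A A') :
    Typed (A' :: Γ) t T := by
  have hΔ : WfCtx (A' :: Γ) := .cons hA'.wf hA'
  rw [← psubst_var t, ← psubst_var T]
  refine ht.psubst hΔ fun n C hn => ?_
  rw [psubst_var]
  cases n with
  | zero =>
    obtain rfl : A = C := by simpa using hn
    refine .conv (.var (n := 0) hΔ rfl) (i := i) ?_ ?_ <;> rw [lift_zero_eq]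
    · exact hA.weaken hΔ
    · rw [lift_zero_eq]
      exact hc.symm.rename _
  | succ n => exact .var hΔ (by simpa using hn)

theorem WfCtx.lookup {Γ : Ctx} : WfCtx Γ → ∀ {n : ℕ} {A : Tm}, Γ[n]? = some A →
    ∃ i, Typed Γ (lift (n + 1) 0 A) (.sort i)
  | .nil, _, _, hn => by simp at hn
  | .cons hΓ hB, n, A, hn => by
    have hΔ := WfCtx.cons hΓ hB
    cases n with
    | zero =>
      obtain rfl := by simpa using hn
      rw [lift_zero_eq]
      exact ⟨_, hB.weaken hΔ⟩
    | succ n =>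
      obtain ⟨i, hi⟩ := hΓ.lookup (n := n) (A := A) (by simpa using hn)
      have := hi.weaken hΔ
      rw [lift_zero_eq, rename_rename] at this
      rw [lift_zero_eq]
      exact ⟨i, this⟩

theorem Typed.validity {Γ : Ctx} {t T : Tm} : Typed Γ t T → ∃ i, Typed Γ T (.sort i)
  | .sort h => ⟨_, .sort h⟩
  | .var h hn => h.lookup hn
  | .pi hA _ => ⟨_, .sort hA.wf⟩
  | .lam hP _ => ⟨_, hP⟩
  | .app ht hu =>
    have ⟨_, hP⟩ := ht.validity
    have ⟨_, hB⟩ := hP.pi_inv.2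
    ⟨_, hB.subst_zero hu⟩
  | .conv _ hB _ => ⟨_, hB⟩

/-- **Subject reduction.** If `Γ ⊢ t : T` and `t → t'` then `Γ ⊢ t' : T`. -/
theorem subject_reduction {Γ : Ctx} {t t' T : Tm}
    (ht : Typed Γ t T) (hr : Red t t') : Typed Γ t' T := by
  match ht with
  | .sort _ => cases hr
  | .var _ _ => cases hr
  | .pi hA hB =>
    cases hr with
    | piDom _ h =>
      have hA' := subject_reduction hA h
      exact .pi hA' (hB.conv_ctx hA hA' h.conv)
    | piCod _ h => exact .pi hA (subject_reduction hB h)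
  | .lam (B := B) hP hb =>
    cases hr with
    | lamDom _ h =>
      have hP' := subject_reduction hP (.piDom B h)
      obtain ⟨⟨_, hA⟩, -⟩ := hP.pi_inv
      obtain ⟨⟨_, hA'⟩, -⟩ := hP'.pi_inv
      exact .conv (.lam hP' (hb.conv_ctx hA hA' h.conv)) hP (Red.piDom B h).conv.symm
    | lamBody _ h => exact .lam hP (subject_reduction hb h)
  | .app (B := B) hf hu =>
    obtain ⟨_, hT⟩ := (Typed.app hf hu).validity
    cases hr with
    | appFun _ h => exact .app (subject_reduction hf h) hu
    | appArg _ h =>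
      exact .conv (.app hf (subject_reduction hu h)) hT
        ((Par.refl B).subst_zero h.par).conv.symm
    | beta =>
      obtain ⟨B', _, hP, hb, hc⟩ := hf.lam_inv
      obtain ⟨hA, hB⟩ := hc.pi_inj
      obtain ⟨⟨_, hA'⟩, -⟩ := hP.pi_inv
      refine .conv (hb.subst_zero (.conv hu hA' hA.symm)) hT ?_
      simpa only [subst_zero_eq] using hB.psubst _
  | .conv h hB hc => exact .conv (subject_reduction h hr) hB hc

end CComega
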